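/- arXiv:2112.15177 — 6 statements merged into one kernel-verified Lean document; each statement's English description precedes it below -/
import Mathlib

section
/- Let a ≥ b ≥ 0 be integers and let h be the Hermitian (a+b)×(a+b) complex matrix in block form h = [[0, h_AB],[h_AB^†, 0]], where h_AB is an arbitrary complex a×b matrix. Then there exist an orthonormal basis ψ_{B,1}, …, ψ_{B,b} of ℂ^b, a complex a×b matrix V with V^†V = 1_b (a linear isometry from ℂ^b into ℂ^a), and orthonormal vectors φ_1, …, φ_{a−b} in ℂ^a such that the a+b vectors ψ_k ∈ ℂ^{a+b} defined by ψ_k = (1/√2)(Vψ_{B,k}, ψ_{B,k}) for k = 1,…,b, ψ_k = (1/√2)(Vψ_{B,k−b}, −ψ_{B,k−b}) for k = b+1,…,2b, and ψ_k = (φ_{k−2b}, 0) for k = 2b+1,…,a+b form an orthonormal basis of ℂ^{a+b} consisting of eigenvectors of h, and moreover h ψ_k = 0 for all k = 2b+1,…,a+b. -/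
open Matrix

open scoped ComplexOrder in
/-- Singular value decomposition of a tall matrix `A`, with an orthonormal completion `F` of the
left singular vectors `W`. -/
theorem Matrix.exists_singular_value_decomposition {m n p : Type*} [Fintype m] [Fintype n]
    [Fintype p] [DecidableEq m] [DecidableEq n] [DecidableEq p]
    (hcard : Fintype.card m = Fintype.card n + Fintype.card p) (A : Matrix m n ℂ) :
    ∃ (U : Matrix n n ℂ) (W : Matrix m n ℂ) (F : Matrix m p ℂ) (s : n → ℝ),
      Uᴴ * U = 1 ∧ Wᴴ * W = 1 ∧ Fᴴ * F = 1 ∧ Wᴴ * F = 0 ∧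
        A * U = W * diagonal (fun k => (s k : ℂ)) := by
  have hA := posSemidef_conjTranspose_mul_self A
  set e := hA.isHermitian.eigenvectorBasis
  set t := hA.isHermitian.eigenvalues
  have ht : ∀ k, 0 ≤ t k := hA.eigenvalues_nonneg
  set u : n → EuclideanSpace ℂ m := fun k => WithLp.toLp 2 (A *ᵥ (e k).ofLp) with hu
  have hinner : ∀ k l, inner ℂ (u k) (u l) = if k = l then (t k : ℂ) else 0 := by
    intro k l
    have h1 : inner ℂ (u k) (u l) = (t l : ℂ) * inner ℂ (e k) (e l) := by
      simp only [hu, EuclideanSpace.inner_eq_star_dotProduct]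
      rw [star_mulVec, dotProduct_comm, ← dotProduct_mulVec, mulVec_mulVec,
        hA.isHermitian.mulVec_eigenvectorBasis l, dotProduct_comm, smul_dotProduct]
      simp [t, e]
    rw [h1, orthonormal_iff_ite.mp e.orthonormal k l]
    split_ifs with hkl <;> simp [hkl]
  have hsq : ∀ k, ((√(t k) : ℝ) : ℂ) * (√(t k) : ℝ) = t k := fun k => by
    rw [← Complex.ofReal_mul, Real.mul_self_sqrt (ht k)]
  set v : n ⊕ p → EuclideanSpace ℂ m :=
    Sum.elim (fun k => ((√(t k) : ℝ) : ℂ)⁻¹ • u k) 0 with hv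
  set S : Set (n ⊕ p) := {x | ∃ k, x = Sum.inl k ∧ t k ≠ 0}
  have hS : Orthonormal ℂ (S.domRestrict v) := by
    rw [orthonormal_iff_ite]
    rintro ⟨_, k, rfl, hk⟩ ⟨_, l, rfl, hl⟩
    change inner ℂ (((√(t k) : ℝ) : ℂ)⁻¹ • u k) (((√(t l) : ℝ) : ℂ)⁻¹ • u l) = _
    simp only [inner_smul_left, inner_smul_right, hinner,
      Subtype.mk.injEq, Sum.inl.injEq]
    split_ifs with hkl
    · subst hkl
      have : ((√(t k) : ℝ) : ℂ) ≠ 0 := by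
        exact_mod_cast (Real.sqrt_ne_zero (ht k)).mpr hk
      rw [← hsq k]
      simp only [map_inv₀, Complex.conj_ofReal]
      field_simp
    · simp
  obtain ⟨w, hw⟩ := hS.exists_orthonormalBasis_extension_of_card_eq
    (by rw [finrank_euclideanSpace, Fintype.card_sum, hcard])
  have hwo : ∀ x y, star (w x).ofLp ⬝ᵥ (w y).ofLp = if x = y then 1 else 0 := fun x y => by
    rw [← orthonormal_iff_ite.mp w.orthonormal x y, EuclideanSpace.inner_eq_star_dotProduct,
      dotProduct_comm]
  have huw : ∀ k, u k = ((√(t k) : ℝ) : ℂ) • w (Sum.inl k) := by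
    intro k
    by_cases hk : t k = 0
    · have : u k = 0 := by
        rw [← inner_self_eq_zero (𝕜 := ℂ), hinner, if_pos rfl, hk, Complex.ofReal_zero]
      simp [this, hk]
    · rw [hw _ ⟨k, rfl, hk⟩, hv, Sum.elim_inl, smul_inv_smul₀]
      exact_mod_cast (Real.sqrt_ne_zero (ht k)).mpr hk
  refine ⟨of fun i k => e k i, of fun i k => w (Sum.inl k) i, of fun i l => w (Sum.inr l) i,
    fun k => √(t k), ?_, ?_, ?_, ?_, ?_⟩
  · ext k l
    rw [one_apply, ← orthonormal_iff_ite.mp e.orthonormal k l,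
      EuclideanSpace.inner_eq_star_dotProduct, dotProduct_comm]
    rfl
  · ext k l
    simp only [one_apply]
    exact (hwo (Sum.inl k) (Sum.inl l)).trans (by simp)
  · ext k l
    simp only [one_apply]
    exact (hwo (Sum.inr k) (Sum.inr l)).trans (by simp)
  · ext k l
    exact (hwo (Sum.inl k) (Sum.inr l)).trans (by simp)
  · ext i k
    rw [mul_diagonal, mul_comm]
    exact congrArg (fun x : EuclideanSpace ℂ m => x i) (huw k)

/-- Lemma 1 of the paper: structure of an orthonormal eigenbasis of a Hermitian matrix
with sublattice symmetry `h = [[0, h_AB], [h_AB^†, 0]]` with `a ≥ b`.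
The `a + b` eigenvectors are indexed by `Fin b ⊕ Fin b ⊕ Fin (a - b)`,
corresponding to `k = 1,…,b`, `k = b+1,…,2b` and `k = 2b+1,…,a+b` respectively. -/
theorem sublattice_eigenbasis_structure (a b : ℕ) (hab : b ≤ a)
    (hAB : Matrix (Fin a) (Fin b) ℂ)
    (h : Matrix (Fin a ⊕ Fin b) (Fin a ⊕ Fin b) ℂ)
    (hdef : h = Matrix.fromBlocks 0 hAB hABᴴ 0) :
    ∃ (ψB : Fin b → (Fin b → ℂ)) (V : Matrix (Fin a) (Fin b) ℂ)
      (φ : Fin (a - b) → (Fin a → ℂ)),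
      -- ψB is an orthonormal basis of ℂ^b
      (∀ k l : Fin b, star (ψB k) ⬝ᵥ ψB l = if k = l then 1 else 0) ∧
      -- V is an isometry ℂ^b → ℂ^a
      Vᴴ * V = 1 ∧
      -- the φ_l are orthonormal in ℂ^a
      (∀ l m : Fin (a - b), star (φ l) ⬝ᵥ φ m = if l = m then 1 else 0) ∧
      -- the family ψ of a+b vectors built from these data:
      ∃ ψ : Fin b ⊕ Fin b ⊕ Fin (a - b) → (Fin a ⊕ Fin b → ℂ),
        (∀ k : Fin b, ψ (Sum.inl k) =
            Sum.elim (fun i => (1 / Real.sqrt 2 : ℂ) * V.mulVec (ψB k) i)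
                     (fun j => (1 / Real.sqrt 2 : ℂ) * ψB k j)) ∧
        (∀ k : Fin b, ψ (Sum.inr (Sum.inl k)) =
            Sum.elim (fun i => (1 / Real.sqrt 2 : ℂ) * V.mulVec (ψB k) i)
                     (fun j => -((1 / Real.sqrt 2 : ℂ) * ψB k j))) ∧
        (∀ l : Fin (a - b), ψ (Sum.inr (Sum.inr l)) = Sum.elim (φ l) 0) ∧
        -- ψ is an orthonormal basis of ℂ^{a+b}
        (∀ k l, star (ψ k) ⬝ᵥ ψ l = if k = l then 1 else 0) ∧
        -- each ψ_k is an eigenvector of h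
        (∀ k, ∃ ε : ℝ, h.mulVec (ψ k) = (ε : ℂ) • ψ k) ∧
        -- the last a-b vectors are zero modes
        (∀ l : Fin (a - b), h.mulVec (ψ (Sum.inr (Sum.inr l))) = 0) := by
  subst hdef
  obtain ⟨U, W, F, s, hU, hW, hF, hWF, hs⟩ :=
    exists_singular_value_decomposition (p := Fin (a - b)) (by simp [hab]) hAB
  have hU' : U * Uᴴ = 1 := mul_eq_one_comm.mp hU
  have hFW : Fᴴ * W = 0 := by simpa using congrArg conjTranspose hWF
  have hA : hABᴴ = U * (diagonal (fun k => (s k : ℂ)) * Wᴴ) := by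
    have h1 := congrArg (fun M => U * Mᴴ) hs
    simp only [conjTranspose_mul, ← Matrix.mul_assoc, hU', Matrix.one_mul,
      diagonal_conjTranspose] at h1
    rw [h1, Matrix.mul_assoc]
    congr 3
    ext k
    simp
  have hAW : hABᴴ * W = U * diagonal (fun k => (s k : ℂ)) := by
    rw [hA, Matrix.mul_assoc, Matrix.mul_assoc, hW, Matrix.mul_one]
  have hAF : hABᴴ * F = 0 := by
    rw [hA, Matrix.mul_assoc, Matrix.mul_assoc, hWF, Matrix.mul_zero, Matrix.mul_zero]
  have hV : ∀ k, (W * Uᴴ) *ᵥ U.col k = W.col k := fun k => by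
    change ((W * Uᴴ) * U).col k = _
    rw [Matrix.mul_assoc, hU, Matrix.mul_one]
  have hAU_col : ∀ k, hAB *ᵥ U.col k = (s k : ℂ) • W.col k := fun k => by
    change (hAB * U).col k = _
    rw [hs]
    ext i
    simp [mul_diagonal, mul_comm]
  have hAW_col : ∀ k, hABᴴ *ᵥ W.col k = (s k : ℂ) • U.col k := fun k => by
    change (hABᴴ * W).col k = _
    rw [hAW]
    ext i
    simp [mul_diagonal, mul_comm]
  have hAF_col : ∀ l, hABᴴ *ᵥ F.col l = 0 := fun l => by
    change (hABᴴ * F).col l = _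
    rw [hAF]
    rfl
  have hUo : ∀ k l, star (U.col k) ⬝ᵥ U.col l = if k = l then 1 else 0 := fun k l => by
    rw [← one_apply, ← hU]; rfl
  have hWo : ∀ k l, star (W.col k) ⬝ᵥ W.col l = if k = l then 1 else 0 := fun k l => by
    rw [← one_apply, ← hW]; rfl
  have hFo : ∀ k l, star (F.col k) ⬝ᵥ F.col l = if k = l then 1 else 0 := fun k l => by
    rw [← one_apply, ← hF]; rfl
  have hWFo : ∀ k l, star (W.col k) ⬝ᵥ F.col l = 0 := fun k l => congrFun₂ hWF k l
  have hFWo : ∀ k l, star (F.col k) ⬝ᵥ W.col l = 0 := fun k l => congrFun₂ hFW k l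
  have hstar : ∀ (x : Fin a → ℂ) (y : Fin b → ℂ),
      star (Sum.elim x y) = Sum.elim (star x) (star y) := fun x y => by
    ext (i | i) <;> rfl
  have hsmul : ∀ (r : ℂ) (x : Fin a → ℂ) (y : Fin b → ℂ),
      r • Sum.elim x y = Sum.elim (r • x) (r • y) := fun r x y => by
    ext (i | i) <;> rfl
  have hmul : ∀ (x : Fin a → ℂ) (y : Fin b → ℂ),
      fromBlocks 0 hAB hABᴴ 0 *ᵥ Sum.elim x y = Sum.elim (hAB *ᵥ y) (hABᴴ *ᵥ x) := fun x y => by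
    simp [fromBlocks_mulVec]
  have hzero : ∀ l, fromBlocks 0 hAB hABᴴ 0 *ᵥ Sum.elim (F.col l) 0 = 0 := fun l => by
    rw [hmul, hAF_col, mulVec_zero, Sum.elim_zero_zero]
  set c : ℂ := 1 / Real.sqrt 2 with hc
  have hcc : star c * c = 1 / 2 := by
    have h2 : (Real.sqrt 2 : ℂ) * Real.sqrt 2 = 2 := by
      rw [← Complex.ofReal_mul, Real.mul_self_sqrt zero_le_two, Complex.ofReal_ofNat]
    have : star c = c := by simp [hc]
    rw [this, hc, div_mul_div_comm, h2, one_mul]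
  refine ⟨U.col, W * Uᴴ, F.col, hUo, ?_, hFo,
    Sum.elim (fun k => Sum.elim (c • W.col k) (c • U.col k))
      (Sum.elim (fun k => Sum.elim (c • W.col k) (-(c • U.col k)))
        (fun l => Sum.elim (F.col l) 0)), ?_, ?_, fun l => rfl, ?_, ?_, ?_⟩
  · rw [conjTranspose_mul, conjTranspose_conjTranspose, Matrix.mul_assoc, ← Matrix.mul_assoc Wᴴ,
      hW, Matrix.one_mul, hU']
  · intro k
    rw [hV]
    rfl
  · intro k
    rw [hV]
    rfl
  · rintro (k | k | k) (l | l | l) <;>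
      simp only [Sum.elim_inl, Sum.elim_inr, hstar, sumElim_dotProduct_sumElim, star_smul, star_neg,
        star_zero, smul_dotProduct, dotProduct_smul, neg_dotProduct, dotProduct_neg, smul_eq_mul,
        zero_dotProduct, dotProduct_zero, hUo, hWo, hFo, hWFo, hFWo, Sum.inl.injEq, Sum.inr.injEq,
        reduceCtorEq, if_false]
    all_goals try split_ifs
    all_goals first | ring1 | linear_combination 2 * hcc
  · rintro (k | k | l)
    · refine ⟨s k, ?_⟩
      simp only [Sum.elim_inl, hmul, mulVec_smul, hAU_col, hAW_col, hsmul, smul_comm c]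
    · refine ⟨-s k, ?_⟩
      simp only [Sum.elim_inl, Sum.elim_inr, hmul, mulVec_smul, mulVec_neg, hAU_col, hAW_col,
        hsmul, smul_comm c, Complex.ofReal_neg, neg_smul, smul_neg, neg_neg]
    · exact ⟨0, by simp only [Sum.elim_inr, hzero, Complex.ofReal_zero, zero_smul]⟩
  · exact hzero
end

section
/- Let a ≥ b ≥ 0 and let ψ_1, …, ψ_{a+b} be an orthonormal basis of ℂ^{a+b} with the structure guaranteed by Lemma 1: there is an orthonormal basis ψ_{B,1}, …, ψ_{B,b} of ℂ^b such that the B-component of ψ_k equals (1/√2)ψ_{B,k} for k = 1,…,b, equals −(1/√2)ψ_{B,k−b} for k = b+1,…,2b, and equals 0 for k > 2b. For any s ∈ {0,1}^{a+b} define the b×b matrix C^s by (C^s)_{ij} = Σ_{k=1}^{a+b} s_k (ψ_k)_B(i) · conj((ψ_k)_B(j)). Then C^s = Σ_{k=1}^{b} ((s_k + s_{k+b})/2) ψ_{B,k} ψ_{B,k}^†; consequently C^s is Hermitian, every eigenvalue of C^s lies in {0, 1/2, 1}, and the multiplicity of the eigenvalue 1/2 equals n(s) := #{k ∈ {1,…,b}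 : s_k ≠ s_{k+b}}. -/
open Matrix Module

/-- The eigenspace of a unitarily diagonalized matrix `U * diagonal d * Uᴴ` for `μ` has dimension
the number of occurrences of `μ` in `d`. -/
theorem finrank_eigenspace_unitary_conj_diagonal {n : Type*} [Fintype n] [DecidableEq n]
    (U : Matrix n n ℂ) (hU : Uᴴ * U = 1) (d : n → ℂ) (μ : ℂ) :
    Module.finrank ℂ (Module.End.eigenspace (Matrix.toLin' (U * diagonal d * Uᴴ)) μ)
      = (Finset.univ.filter (fun k => d k = μ)).card := by
  have hU' : U * Uᴴ = 1 := mul_eq_one_comm.mp hU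
  have hdet : IsUnit U.det := (Matrix.isUnit_iff_isUnit_det U).mp (IsUnit.of_mul_eq_one _ hU')
  have hdet' : IsUnit Uᴴ.det := (Matrix.isUnit_iff_isUnit_det _).mp (IsUnit.of_mul_eq_one _ hU)
  have hsub : U * diagonal d * Uᴴ - μ • 1 = U * diagonal (fun k => d k - μ) * Uᴴ := by
    have h : diagonal (fun k => d k - μ) = diagonal d - μ • (1 : Matrix n n ℂ) := by
      rw [smul_one_eq_diagonal, diagonal_sub]
    rw [h, mul_sub, sub_mul, mul_smul_comm, mul_one, smul_mul_assoc, hU']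
  have hker : Module.End.eigenspace (Matrix.toLin' (U * diagonal d * Uᴴ)) μ
      = LinearMap.ker (U * diagonal (fun k => d k - μ) * Uᴴ).mulVecLin := by
    ext v
    rw [Module.End.mem_eigenspace_iff, LinearMap.mem_ker, ← hsub, mulVecLin_apply, sub_mulVec,
      smul_mulVec, one_mulVec, sub_eq_zero, toLin'_apply]
  have hrank : (U * diagonal (fun k => d k - μ) * Uᴴ).rank
      = (Finset.univ.filter (fun k => d k ≠ μ)).card := by
    rw [rank_mul_eq_left_of_isUnit_det _ _ hdet', rank_mul_eq_right_of_isUnit_det _ _ hdet,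
      rank_diagonal, Fintype.card_subtype]
    simp only [ne_eq, sub_eq_zero]
  have hsum := LinearMap.finrank_range_add_finrank_ker
    (U * diagonal (fun k => d k - μ) * Uᴴ).mulVecLin
  rw [← Matrix.rank, hrank, Module.finrank_fintype_fun_eq_card] at hsum
  have hcard := Finset.card_filter_add_card_filter_not (s := (Finset.univ : Finset n))
    (fun k => d k = μ)
  rw [Finset.card_univ] at hcard
  rw [hker]
  simp only [ne_eq] at hsum
  lia

/-- The two-point correlation matrix on sublattice `B` of the fermionic eigenstate `|E_s⟩`:
with the eigenbasis structure of Lemma 1 (indexing `k = 1..b`, `k = b+1..2b`,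
`k = 2b+1..a+b` by `Fin b ⊕ Fin b ⊕ Fin (a-b)`), the matrix
`(C^s)_{ij} = Σ_k s_k (ψ_k)_B(i) conj((ψ_k)_B(j))` equals
`Σ_{k=1}^b ((s_k + s_{k+b})/2) ψ_{B,k} ψ_{B,k}^†`; it is Hermitian with eigenvalues in
`{0, 1/2, 1}`, and the multiplicity of `1/2` is `n(s) = #{k : s_k ≠ s_{k+b}}`. -/
theorem correlation_matrix_quantized (a b : ℕ) (hab : b ≤ a)
    (ψB : Fin b → (Fin b → ℂ))
    (hψB : ∀ k l : Fin b, star (ψB k) ⬝ᵥ ψB l = if k = l then 1 else 0)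
    (ψ : Fin b ⊕ Fin b ⊕ Fin (a - b) → (Fin a ⊕ Fin b → ℂ))
    (hortho : ∀ k l, star (ψ k) ⬝ᵥ ψ l = if k = l then 1 else 0)
    (hB1 : ∀ (k : Fin b) (i : Fin b),
      ψ (Sum.inl k) (Sum.inr i) = (1 / Real.sqrt 2 : ℂ) * ψB k i)
    (hB2 : ∀ (k : Fin b) (i : Fin b),
      ψ (Sum.inr (Sum.inl k)) (Sum.inr i) = -((1 / Real.sqrt 2 : ℂ) * ψB k i))
    (hB3 : ∀ (l : Fin (a - b)) (i : Fin b), ψ (Sum.inr (Sum.inr l)) (Sum.inr i) = 0)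
    (s : Fin b ⊕ Fin b ⊕ Fin (a - b) → Fin 2)
    (C : Matrix (Fin b) (Fin b) ℂ)
    (hC : ∀ i j : Fin b,
      C i j = ∑ k, ((s k : ℕ) : ℂ) * ψ k (Sum.inr i) * starRingEnd ℂ (ψ k (Sum.inr j))) :
    (∀ i j : Fin b, C i j = ∑ k : Fin b,
        (((s (Sum.inl k) : ℕ) + (s (Sum.inr (Sum.inl k)) : ℕ) : ℂ) / 2)
          * ψB k i * starRingEnd ℂ (ψB k j)) ∧
    C.IsHermitian ∧
    (∀ μ : ℂ, Module.End.HasEigenvalue (Matrix.toLin' C) μ →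
      μ ∈ ({0, 1 / 2, 1} : Set ℂ)) ∧
    Module.finrank ℂ (Module.End.eigenspace (Matrix.toLin' C) (1 / 2 : ℂ))
      = (Finset.univ.filter
          (fun k : Fin b => s (Sum.inl k) ≠ s (Sum.inr (Sum.inl k)))).card := by
  have hsqrt : (1 / Real.sqrt 2 : ℂ) * (1 / Real.sqrt 2 : ℂ) = 1 / 2 := by
    rw [div_mul_div_comm, ← Complex.ofReal_mul, Real.mul_self_sqrt zero_le_two]
    norm_num
  have hconj : starRingEnd ℂ (1 / Real.sqrt 2 : ℂ) = 1 / Real.sqrt 2 := by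
    simp [Complex.conj_ofReal]
  have hsum : ∀ i j : Fin b, C i j = ∑ k : Fin b,
      (((s (Sum.inl k) : ℕ) + (s (Sum.inr (Sum.inl k)) : ℕ) : ℂ) / 2)
        * ψB k i * starRingEnd ℂ (ψB k j) := by
    intro i j
    rw [hC, Fintype.sum_sum_type, Fintype.sum_sum_type]
    simp only [hB1, hB2, hB3, mul_zero, zero_mul, Finset.sum_const_zero, add_zero]
    rw [← Finset.sum_add_distrib]
    refine Finset.sum_congr rfl fun k _ => ?_
    rw [map_neg, map_mul, hconj]
    linear_combination (((s (Sum.inl k) : ℕ) + (s (Sum.inr (Sum.inl k)) : ℕ) : ℂ))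
        * ψB k i * starRingEnd ℂ (ψB k j) * hsqrt
  set d : Fin b → ℂ :=
    fun k => ((s (Sum.inl k) : ℕ) + (s (Sum.inr (Sum.inl k)) : ℕ) : ℂ) / 2 with hd
  set U : Matrix (Fin b) (Fin b) ℂ := Matrix.of fun i k => ψB k i with hUdef
  have hU : Uᴴ * U = 1 := by
    ext k l
    rw [one_apply, ← hψB k l]
    rfl
  have hCU : C = U * diagonal d * Uᴴ := by
    ext i j
    rw [hsum, mul_apply]
    refine Finset.sum_congr rfl fun k _ => ?_
    rw [mul_diagonal, conjTranspose_apply, mul_comm (U i k)]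
    rfl
  refine ⟨hsum, ?_, fun μ hμ => ?_, ?_⟩
  · rw [hCU]
    refine isHermitian_mul_mul_conjTranspose U (isHermitian_diagonal_of_self_adjoint d ?_)
    ext k
    simp [hd]
  · have hpos := Submodule.one_le_finrank_iff.mpr hμ
    rw [hCU, finrank_eigenspace_unitary_conj_diagonal U hU] at hpos
    obtain ⟨k, hk⟩ := Finset.card_pos.mp hpos
    rw [← (Finset.mem_filter.mp hk).2]
    simp only [hd]
    generalize s (Sum.inl k) = x
    generalize s (Sum.inr (Sum.inl k)) = y
    fin_cases x <;> fin_cases y <;> norm_num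
  · rw [hCU, finrank_eigenspace_unitary_conj_diagonal U hU]
    congr 1
    refine Finset.filter_congr fun k _ => ?_
    simp only [hd]
    generalize s (Sum.inl k) = x
    generalize s (Sum.inr (Sum.inl k)) = y
    fin_cases x <;> fin_cases y <;> norm_num
end

section
/- Let a ≥ b ≥ 0 and let ψ_1, …, ψ_{a+b} be an orthonormal basis of ℂ^{a+b} of eigenvectors of a matrix with eigenvalues ε_1, …, ε_{a+b} ∈ ℝ, with the structure guaranteed by Lemma 1: there is an orthonormal basis ψ_{B,1}, …, ψ_{B,b} of ℂ^b such that the B-component of ψ_k equals (1/√2)ψ_{B,k} for k = 1,…,b, equals −(1/√2)ψ_{B,k−b} for k = b+1,…,2b, and equals 0 for k > 2b, and such that ε_{k+b} = −ε_k for k = 1,…,b and ε_k = 0 for k > 2b. Then there exists s ∈ {0,1}^{a+b} such that Σ_k s_k ε_k ≤ Σ_k s'_k ε_k for all s' ∈ {0,1}^{a+b}, and such that for all i, j ∈ {1,…,b}: Σ_{k=1}^{a+b} s_k (ψ_k)_B(i) · conj((ψ_k)_B(j)) = (1/2)δ_{ij}. -/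
open Matrix

/-- Completeness relation of an orthonormal family of full size. -/
theorem sum_mul_conj_of_orthonormal {n : Type*} [Fintype n] [DecidableEq n] (v : n → n → ℂ)
    (hv : ∀ k l, star (v k) ⬝ᵥ v l = if k = l then 1 else 0) (i j : n) :
    ∑ k, v k i * starRingEnd ℂ (v k j) = if i = j then 1 else 0 := by
  have h1 : Matrix.of v * (Matrix.of v)ᴴ = 1 := by
    ext k l
    have h := hv l k
    simp only [dotProduct, Pi.star_apply] at h
    simp only [mul_apply, conjTranspose_apply, of_apply, one_apply, mul_comm (v k _), h, eq_comm]
  have h2 := congrFun₂ (mul_eq_one_comm.mp h1 : (Matrix.of v)ᴴ * Matrix.of v = 1) j i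
  simp only [mul_apply, conjTranspose_apply, of_apply, one_apply] at h2
  simpa only [starRingEnd_apply, mul_comm, eq_comm] using h2

/-- Maximally entangled ground state: given an orthonormal eigenbasis of `ℂ^{a+b}` with
the structure of Lemma 1 (eigenvalues `ε_{k+b} = -ε_k`, `ε_k = 0` for `k > 2b`, and
B-components `±(1/√2)ψ_{B,k}` resp. `0`), there is an energy-minimizing filling
`s ∈ {0,1}^{a+b}` whose two-point correlation matrix restricted to `B` equals `(1/2)·1`. -/
theorem ground_state_maximally_entangled (a b : ℕ) (hab : b ≤ a)
    (h : Matrix (Fin a ⊕ Fin b) (Fin a ⊕ Fin b) ℂ)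
    (ψB : Fin b → (Fin b → ℂ))
    (hψB : ∀ k l : Fin b, star (ψB k) ⬝ᵥ ψB l = if k = l then 1 else 0)
    (ψ : Fin b ⊕ Fin b ⊕ Fin (a - b) → (Fin a ⊕ Fin b → ℂ))
    (ε : Fin b ⊕ Fin b ⊕ Fin (a - b) → ℝ)
    (hortho : ∀ k l, star (ψ k) ⬝ᵥ ψ l = if k = l then 1 else 0)
    (heig : ∀ k, h.mulVec (ψ k) = (ε k : ℂ) • ψ k)
    (hpair : ∀ k : Fin b, ε (Sum.inr (Sum.inl k)) = -ε (Sum.inl k))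
    (hzero : ∀ l : Fin (a - b), ε (Sum.inr (Sum.inr l)) = 0)
    (hB1 : ∀ (k : Fin b) (i : Fin b),
      ψ (Sum.inl k) (Sum.inr i) = (1 / Real.sqrt 2 : ℂ) * ψB k i)
    (hB2 : ∀ (k : Fin b) (i : Fin b),
      ψ (Sum.inr (Sum.inl k)) (Sum.inr i) = -((1 / Real.sqrt 2 : ℂ) * ψB k i))
    (hB3 : ∀ (l : Fin (a - b)) (i : Fin b), ψ (Sum.inr (Sum.inr l)) (Sum.inr i) = 0) :
    ∃ s : Fin b ⊕ Fin b ⊕ Fin (a - b) → Fin 2,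
      (∀ s' : Fin b ⊕ Fin b ⊕ Fin (a - b) → Fin 2,
        ∑ k, ((s k : ℕ) : ℝ) * ε k ≤ ∑ k, ((s' k : ℕ) : ℝ) * ε k) ∧
      (∀ i j : Fin b,
        ∑ k, ((s k : ℕ) : ℂ) * ψ k (Sum.inr i) * starRingEnd ℂ (ψ k (Sum.inr j))
          = if i = j then 1 / 2 else 0) := by
  refine ⟨Sum.elim (fun k => if ε (Sum.inl k) ≤ 0 then 1 else 0)
    (Sum.elim (fun k => if ε (Sum.inl k) ≤ 0 then 0 else 1) fun _ => 0), fun s' => ?_,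
    fun i j => ?_⟩
  · have bound : ∀ x : Fin 2, (0 : ℝ) ≤ ((x : ℕ) : ℝ) ∧ ((x : ℕ) : ℝ) ≤ 1 := fun x =>
      ⟨Nat.cast_nonneg _, by exact_mod_cast Nat.le_of_lt_succ x.isLt⟩
    refine Finset.sum_le_sum fun k _ => ?_
    obtain ⟨h0, h1⟩ := bound (s' k)
    rcases k with k | k | l
    · by_cases hk : ε (Sum.inl k) ≤ 0
      · simp only [Sum.elim_inl, hk, if_true, Fin.val_one, Nat.cast_one]
        nlinarith
      · simp only [Sum.elim_inl, hk, if_false, Fin.val_zero, Nat.cast_zero]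
        nlinarith
    · by_cases hk : ε (Sum.inl k) ≤ 0
      · simp only [Sum.elim_inl, Sum.elim_inr, hk, if_true, Fin.val_zero, Nat.cast_zero, hpair]
        nlinarith
      · simp only [Sum.elim_inl, Sum.elim_inr, hk, if_false, Fin.val_one, Nat.cast_one, hpair]
        nlinarith
    · simp [hzero]
  · have hsqrt : (1 / Real.sqrt 2 : ℂ) * (1 / Real.sqrt 2 : ℂ) = 1 / 2 := by
      rw [div_mul_div_comm, ← Complex.ofReal_mul, Real.mul_self_sqrt zero_le_two]
      norm_num
    have hconj : starRingEnd ℂ (1 / Real.sqrt 2 : ℂ) = 1 / Real.sqrt 2 := by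
      simp
    have key : (1 / 2 : ℂ) * ∑ k, ψB k i * starRingEnd ℂ (ψB k j)
        = if i = j then 1 / 2 else 0 := by
      rw [sum_mul_conj_of_orthonormal ψB hψB, mul_ite, mul_one, mul_zero]
    rw [← key, Fintype.sum_sum_type, Fintype.sum_sum_type, ← add_assoc,
      ← Finset.sum_add_distrib, Finset.mul_sum]
    simp only [Sum.elim_inl, Sum.elim_inr, hB1, hB2, hB3, map_neg, map_mul, hconj, map_zero,
      mul_zero, Finset.sum_const_zero, add_zero]
    refine Finset.sum_congr rfl fun k _ => ?_
    rw [← hsqrt]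
    split_ifs <;>
    · simp only [Fin.val_one, Fin.val_zero, Nat.cast_one, Nat.cast_zero]
      ring
end

section
/- Let h_M be a real antisymmetric 2N×2N matrix (h_M^T = −h_M) and suppose the index set {1,…,2N} is partitioned into two disjoint sets A and B of even sizes |A| ≥ |B| such that (h_M)_{αβ} = 0 whenever α, β ∈ A or α, β ∈ B. Then there exist real vectors r_1, …, r_{2N} forming an orthonormal basis of ℝ^{2N} and real numbers ε_1, …, ε_N ≥ 0 such that h_M = Σ_{k=1}^{N} ε_k (r_{2k} r_{2k−1}^T − r_{2k−1} r_{2k}^T), and such that for every s ∈ {0,1}^N the real antisymmetric matrix Γ_s := −Σ_{k=1}^{N} (−1)^{s_k} (r_{2k} r_{2k−1}^T − r_{2k−1} r_{2k}^T) has vanishing B×B block, i.e. (Γ_s)_{αβ} = 0 for all α, β ∈ B. -/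
open Matrix

/-- The right singular vectors `w` and singular values `σ` of a real matrix. -/
lemma exists_right_singular_vectors {m n : Type*} [Fintype m] [Fintype n] [DecidableEq n]
    (K : Matrix m n ℝ) :
    ∃ (w : n → n → ℝ) (σ : n → ℝ),
      (∀ i j, w i ⬝ᵥ w j = if i = j then 1 else 0) ∧
      (∑ j, vecMulVec (w j) (w j) = 1) ∧ (∀ j, 0 ≤ σ j) ∧
      ∀ i j, (K *ᵥ w i) ⬝ᵥ (K *ᵥ w j) = if i = j then σ i ^ 2 else 0 := by
  have hG : (Kᵀ * K).PosSemidef := by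
    simpa using posSemidef_conjTranspose_mul_self K
  set w : n → n → ℝ := fun j => hG.1.eigenvectorBasis j with hw
  have horth : ∀ i j, w i ⬝ᵥ w j = if i = j then 1 else 0 := by
    intro i j
    have h := orthonormal_iff_ite.1 hG.1.eigenvectorBasis.orthonormal i j
    rw [EuclideanSpace.inner_eq_star_dotProduct] at h
    rw [dotProduct_comm]
    simpa [hw] using h
  refine ⟨w, fun j => √(hG.1.eigenvalues j), horth, ?_, fun j => Real.sqrt_nonneg _, ?_⟩
  · have h : (of w) * (of w)ᵀ = 1 := by
      ext i j
      simpa [mul_apply, dotProduct, one_apply] using horth i j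
    rw [← mul_eq_one_comm.1 h]
    ext a b
    simp [mul_apply, Matrix.sum_apply, vecMulVec_apply]
  · intro i j
    have h : (Kᵀ * K) *ᵥ w j = hG.1.eigenvalues j • w j := hG.1.mulVec_eigenvectorBasis j
    have h' : (K *ᵥ w i) ⬝ᵥ (K *ᵥ w j) = w i ⬝ᵥ ((Kᵀ * K) *ᵥ w j) := by
      rw [← mulVec_mulVec, dotProduct_mulVec (w i), vecMul_transpose]
    rw [h', h, dotProduct_smul, horth, Real.sq_sqrt (hG.eigenvalues_nonneg i)]
    split_ifs with hij <;> simp [hij]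

/-- A partially defined orthonormal family of vectors extends to a full orthonormal basis. -/
lemma exists_orthonormal_extension {ι n : Type*} [Fintype ι] [DecidableEq ι] [Fintype n]
    (hcard : Fintype.card n = Fintype.card ι) (v : ι → n → ℝ) (s : Set ι)
    (hv : ∀ i ∈ s, ∀ j ∈ s, v i ⬝ᵥ v j = if i = j then 1 else 0) :
    ∃ r : ι → n → ℝ, (∀ i j, r i ⬝ᵥ r j = if i = j then 1 else 0) ∧ ∀ i ∈ s, r i = v i := by
  have horth : Orthonormal ℝ (s.domRestrict fun i => WithLp.toLp 2 (v i)) := by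
    classical
    rw [orthonormal_iff_ite]
    rintro ⟨i, hi⟩ ⟨j, hj⟩
    simpa [Set.domRestrict, EuclideanSpace.inner_eq_star_dotProduct, dotProduct_comm] using hv i hi j hj
  obtain ⟨b, hb⟩ := horth.exists_orthonormalBasis_extension_of_card_eq
    (by rw [finrank_euclideanSpace, hcard])
  refine ⟨fun i => b i, fun i j => ?_, fun i hi => by simp [hb i hi]⟩
  have h := orthonormal_iff_ite.1 b.orthonormal i j
  rw [EuclideanSpace.inner_eq_star_dotProduct] at h
  rw [dotProduct_comm]
  simpa using h

/-- Extension by zero of the right singular vectors of the columns of `h` indexed by `B`. -/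
lemma exists_right_singular_vectors_on {n : Type*} [Fintype n] [DecidableEq n]
    (h : Matrix n n ℝ) (B : Finset n) :
    ∃ (v : B → n → ℝ) (σ : B → ℝ),
      (∀ j, ∀ α ∉ B, v j α = 0) ∧
      (∀ i j, v i ⬝ᵥ v j = if i = j then 1 else 0) ∧
      (∑ j, vecMulVec (v j) (v j) = diagonal fun α => if α ∈ B then 1 else 0) ∧
      (∀ j, 0 ≤ σ j) ∧
      ∀ i j, (h *ᵥ v i) ⬝ᵥ (h *ᵥ v j) = if i = j then σ i ^ 2 else 0 := by
  obtain ⟨w, σ, hw, hsum, hσ, hK⟩ :=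
    exists_right_singular_vectors (h.submatrix id ((↑) : B → n))
  set v : B → n → ℝ := fun j α => if hα : α ∈ B then w j ⟨α, hα⟩ else 0 with hv
  have hdot : ∀ (x : n → ℝ) (j : B), x ⬝ᵥ v j = (fun β : B => x β) ⬝ᵥ w j := by
    intro x j
    simp only [dotProduct, hv]
    rw [← Finset.sum_subset (Finset.subset_univ B)
      (fun α _ hα => by simp [hα]), ← Finset.sum_coe_sort B]
    simp
  have hmul : ∀ j, h *ᵥ v j = h.submatrix id ((↑) : B → n) *ᵥ w j := fun j => by
    ext α
    exact hdot (h α) j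
  refine ⟨v, σ, fun j α hα => by simp [hv, hα], fun i j => ?_, ?_, hσ, fun i j => ?_⟩
  · rw [hdot, ← hw]
    simp [hv]
  · ext α β
    rw [Matrix.sum_apply]
    simp only [vecMulVec_apply]
    by_cases hα : α ∈ B
    · by_cases hβ : β ∈ B
      · have h := congrFun (congrFun hsum ⟨α, hα⟩) ⟨β, hβ⟩
        rw [Matrix.sum_apply] at h
        simpa [hv, hα, hβ, diagonal_apply, one_apply, vecMulVec_apply] using h
      · have hne : α ≠ β := fun h => hβ (h ▸ hα)
        simp [hv, hβ, hne]
    · simp [hv, hα, diagonal_apply]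
  · rw [hmul, hmul, hK]

/-- Theorem 1, part 2 (Majorana version): a real antisymmetric matrix with sublattice
symmetry between Majorana sets `A` and `B` (both of even size, `|A| ≥ |B|`) admits a
normal form `h_M = Σ_k ε_k (r_{2k} r_{2k-1}^T - r_{2k-1} r_{2k}^T)` with orthonormal `r`'s
and `ε_k ≥ 0`, such that for every filling `s` the covariance matrix
`Γ_s = -Σ_k (-1)^{s_k} (r_{2k} r_{2k-1}^T - r_{2k-1} r_{2k}^T)` of the eigenstate `|E_s⟩`
has vanishing `B×B` block: every such eigenstate is maximally entangled. -/
theorem majorana_eigenstates_maximally_entangled (N : ℕ)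
    (hM : Matrix (Fin (2 * N)) (Fin (2 * N)) ℝ)
    (hanti : hMᵀ = -hM)
    (A B : Finset (Fin (2 * N)))
    (hdisj : Disjoint A B) (hcover : A ∪ B = Finset.univ)
    (hAeven : Even A.card) (hBeven : Even B.card) (hsize : B.card ≤ A.card)
    (hsub : ∀ α β : Fin (2 * N),
      ((α ∈ A ∧ β ∈ A) ∨ (α ∈ B ∧ β ∈ B)) → hM α β = 0) :
    ∃ (r : Fin N × Fin 2 → (Fin (2 * N) → ℝ)) (ε : Fin N → ℝ),
      (∀ k l : Fin N × Fin 2, r k ⬝ᵥ r l = if k = l then 1 else 0) ∧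
      (∀ k, 0 ≤ ε k) ∧
      hM = ∑ k : Fin N, ε k •
        (vecMulVec (r (k, 1)) (r (k, 0)) - vecMulVec (r (k, 0)) (r (k, 1))) ∧
      ∀ s : Fin N → Fin 2, ∀ α ∈ B, ∀ β ∈ B,
        (-(∑ k : Fin N, ((-1 : ℝ) ^ (s k : ℕ)) •
            (vecMulVec (r (k, 1)) (r (k, 0)) - vecMulVec (r (k, 0)) (r (k, 1)))))
          α β = 0 := by
  obtain ⟨v, σ, hvB, hv, hsum, hσ, hhv⟩ := exists_right_singular_vectors_on hM B
  have hA : ∀ {α}, α ∉ B → α ∈ A := fun {α} hα =>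
    (Finset.mem_union.1 (hcover ▸ Finset.mem_univ α)).resolve_right hα
  have hcardN : B.card ≤ N := by
    have h := Finset.card_union_of_disjoint hdisj
    rw [hcover, Finset.card_univ, Fintype.card_fin] at h
    omega
  obtain ⟨f⟩ : Nonempty (B ↪ Fin N) :=
    Function.Embedding.nonempty_of_card_le (by simpa using hcardN)
  have hhvB : ∀ j, ∀ α ∈ B, (hM *ᵥ v j) α = 0 := by
    intro j α hα
    rw [mulVec, dotProduct]
    refine Finset.sum_eq_zero fun β _ => ?_
    by_cases hβ : β ∈ B
    · simp [hsub α β (Or.inr ⟨hα, hβ⟩)]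
    · simp [hvB j β hβ]
  have hcross : ∀ i j, v i ⬝ᵥ (hM *ᵥ v j) = 0 := by
    intro i j
    refine Finset.sum_eq_zero fun β _ => ?_
    by_cases hβ : β ∈ B
    · simp [hhvB j β hβ]
    · simp [hvB i β hβ]
  set p : Fin N × Fin 2 → Fin (2 * N) → ℝ := fun k =>
    Function.extend f (fun j => if k.2 = 0 then v j else (σ j)⁻¹ • (hM *ᵥ v j)) 0 k.1 with hp
  have hp0 : ∀ j, p (f j, 0) = v j := fun j => by simp [hp, f.injective.extend_apply]
  have hp1 : ∀ j, p (f j, 1) = (σ j)⁻¹ • (hM *ᵥ v j) := fun j => by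
    simp [hp, f.injective.extend_apply]
  obtain ⟨r, hr, hrp⟩ := exists_orthonormal_extension (by simp [mul_comm]) p
    {k | ∃ j, k = (f j, 0) ∨ (k = (f j, 1) ∧ σ j ≠ 0)} (by
      rintro _ ⟨i, rfl | ⟨rfl, hi⟩⟩ _ ⟨j, rfl | ⟨rfl, hj⟩⟩
      · simp [hp0, hv]
      · simp [hp0, hp1, hcross]
      · simp [hp0, hp1, dotProduct_comm _ (v _), hcross]
      · simp only [hp1, smul_dotProduct, dotProduct_smul, hhv, Prod.mk.injEq, and_true,
          f.injective.eq_iff, smul_eq_mul]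
        split_ifs with hij
        · subst hij
          field_simp
        · simp)
  have hr0 : ∀ j, r (f j, 0) = v j := fun j => (hrp _ ⟨j, Or.inl rfl⟩).trans (hp0 j)
  have hr1 : ∀ j, σ j • r (f j, 1) = hM *ᵥ v j := by
    intro j
    by_cases hj : σ j = 0
    · have h := hhv j j
      rw [if_pos rfl, hj, zero_pow two_ne_zero, dotProduct_self_eq_zero] at h
      rw [hj, h, zero_smul]
    · rw [hrp _ ⟨j, Or.inr ⟨rfl, hj⟩⟩, hp1, smul_smul, mul_inv_cancel₀ hj, one_smul]
  have hr1B : ∀ k, ∀ α ∈ B, r (k, 1) α = 0 := by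
    intro k α hα
    have h : (∑ j, vecMulVec (v j) (v j)) *ᵥ r (k, 1) = 0 := by
      rw [sum_mulVec]
      refine Finset.sum_eq_zero fun j _ => ?_
      rw [vecMulVec_mulVec, ← hr0, hr]
      simp
    rw [hsum] at h
    simpa [mulVec_diagonal, hα] using congrFun h α
  set ε : Fin N → ℝ := Function.extend f σ 0 with hε
  have hεf : ∀ j, ε (f j) = σ j := fun j => f.injective.extend_apply _ _ j
  have hεr : ∀ k ∉ Set.range f, ε k = 0 := fun k hk =>
    Function.extend_apply' _ _ _ hk
  refine ⟨r, ε, hr, fun k => ?_, ?_, fun s α hα β hβ => ?_⟩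
  · by_cases hk : k ∈ Set.range f
    · obtain ⟨j, rfl⟩ := hk
      exact hεf j ▸ hσ j
    · exact (hεr k hk).ge
  · have hP : hM * (∑ j, vecMulVec (v j) (v j)) =
        ∑ j, σ j • vecMulVec (r (f j, 1)) (r (f j, 0)) := by
      rw [Finset.mul_sum]
      refine Finset.sum_congr rfl fun j _ => ?_
      rw [mul_vecMulVec, ← hr1, hr0, smul_vecMulVec]
    have hsplit : hM = hM * (∑ j, vecMulVec (v j) (v j))
        - (hM * (∑ j, vecMulVec (v j) (v j)))ᵀ := by
      rw [hsum, transpose_mul, hanti, diagonal_transpose]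
      ext α β
      simp only [Matrix.sub_apply, mul_diagonal, diagonal_mul, Matrix.neg_apply]
      by_cases hα : α ∈ B <;> by_cases hβ : β ∈ B <;> simp [hα, hβ]
      · exact hsub α β (Or.inr ⟨hα, hβ⟩)
      · exact hsub α β (Or.inl ⟨hA hα, hA hβ⟩)
    have hreindex : ∑ k, ε k •
          (vecMulVec (r (k, 1)) (r (k, 0)) - vecMulVec (r (k, 0)) (r (k, 1))) =
        ∑ j, σ j • (vecMulVec (r (f j, 1)) (r (f j, 0)) -
          vecMulVec (r (f j, 0)) (r (f j, 1))) :=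
      (Fintype.sum_of_injective f f.injective _ _
        (fun k hk => by rw [hεr k hk, zero_smul]) (fun j => by rw [hεf])).symm
    rw [hreindex, hsplit, hP, transpose_sum, ← Finset.sum_sub_distrib]
    refine Finset.sum_congr rfl fun j _ => ?_
    rw [transpose_smul, transpose_vecMulVec, smul_sub]
  · simp [Matrix.sum_apply, vecMulVec_apply, hr1B _ α hα, hr1B _ β hβ]
end

section
/- Let m ≥ 1 and let ψ_1, …, ψ_m ∈ ℂ^{2m} be vectors such that the 2m vectors ψ_1, …, ψ_m, conj(ψ_1), …, conj(ψ_m) are orthonormal. For s ∈ {0,1}^{2m} define the matrix Γ_s := −(i/2) Σ_{k=1}^{m} ((−1)^{s_k} − (−1)^{s_{k+m}}) (P_k − conj(P_k)), where P_k := ψ_k ψ_k^†. Then (i Γ_s)² = Σ_{k : s_k ≠ s_{k+m}} (ψ_k ψ_k^† + conj(ψ_k) conj(ψ_k)^†); consequently every eigenvalue of the Hermitian matrix i Γ_s lies in {−1, 0, 1}, the rank of Γ_s equals 2·#{k ∈ {1,…,m} : s_k ≠ s_{k+m}}, and the dimension of the kernel of Γ_s equals 2·#{k ∈ {1,…,m}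 : s_k = s_{k+m}}. -/
open Matrix Module

/-- The rank of a matrix that is diagonal in an orthonormal family (the columns of `V`) is the
number of its nonzero diagonal entries. -/
theorem rank_unitary_conj_diagonal {n ι : Type*} [Fintype n] [Fintype ι] [DecidableEq n]
    [DecidableEq ι] (V : Matrix n ι ℂ) (hV : Vᴴ * V = 1) (d : ι → ℂ) :
    (V * diagonal d * Vᴴ).rank = (Finset.univ.filter (fun k => d k ≠ 0)).card := by
  have h : (V * diagonal d * Vᴴ).rank = (diagonal d).rank := by
    apply le_antisymm
    · exact (rank_mul_le_left _ _).trans (rank_mul_le_right _ _)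
    · have h' : diagonal d = Vᴴ * (V * diagonal d * Vᴴ) * V := by
        calc diagonal d = (Vᴴ * V) * diagonal d * (Vᴴ * V) := by simp [hV]
          _ = _ := by simp only [Matrix.mul_assoc]
      conv_lhs => rw [h']
      exact (rank_mul_le_left _ _).trans (rank_mul_le_right _ _)
  rw [h, rank_diagonal, Fintype.card_subtype]

/-- The product of two matrices diagonal in the same orthonormal family. -/
theorem unitary_conj_diagonal_mul {n ι : Type*} [Fintype n] [Fintype ι]
    [DecidableEq ι] (V : Matrix n ι ℂ) (hV : Vᴴ * V = 1) (d e : ι → ℂ) :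
    (V * diagonal d * Vᴴ) * (V * diagonal e * Vᴴ) = V * diagonal (fun k => d k * e k) * Vᴴ := by
  calc _ = V * diagonal d * (Vᴴ * V) * diagonal e * Vᴴ := by simp only [Matrix.mul_assoc]
    _ = _ := by rw [hV, Matrix.mul_one, Matrix.mul_assoc V, diagonal_mul_diagonal]

/-- An eigenvalue of a matrix with `A³ = A` is `-1`, `0` or `1`. -/
theorem eigenvalue_mem_of_cube_eq {n : Type*} [Fintype n] [DecidableEq n] (A : Matrix n n ℂ)
    (hA : A * A * A = A) (μ : ℂ) (hμ : Module.End.HasEigenvalue (Matrix.toLin' A) μ) :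
    μ ∈ ({-1, 0, 1} : Set ℂ) := by
  obtain ⟨v, hv⟩ := hμ.exists_hasEigenvector
  have h1 : A *ᵥ v = μ • v := by simpa using hv.apply_eq_smul
  have h2 : (A * A * A) *ᵥ v = (μ * μ * μ) • v := by
    simp only [← mulVec_mulVec, h1, mulVec_smul, smul_smul, mul_assoc]
  rw [hA, h1] at h2
  have h3 : μ = μ * μ * μ := smul_left_injective ℂ hv.2 h2
  have h4 : (μ + 1) * (μ * (μ - 1)) = 0 := by linear_combination -h3
  simp only [Set.mem_insert_iff, Set.mem_singleton_iff]
  rcases mul_eq_zero.1 h4 with h | h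
  · exact Or.inl (eq_neg_of_add_eq_zero_left h)
  · rcases mul_eq_zero.1 h with h | h
    · exact Or.inr (Or.inl h)
    · exact Or.inr (Or.inr (sub_eq_zero.1 h))

/-- Quantized eigenstate entanglement, number-conserving case: for orthonormal
`ψ_1, …, ψ_m, conj ψ_1, …, conj ψ_m` in `ℂ^{2m}` and the restricted covariance matrix
`Γ_s = −(i/2) Σ_k ((−1)^{s_k} − (−1)^{s_{k+m}}) (P_k − conj P_k)` with `P_k = ψ_k ψ_k^†`,
one has `(iΓ_s)² = Σ_{k : s_k ≠ s_{k+m}} (ψ_k ψ_k^† + conj ψ_k conj ψ_k^†)`; hence the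
eigenvalues of `iΓ_s` lie in `{−1, 0, 1}`, `rank Γ_s = 2·#{k : s_k ≠ s_{k+m}}` and
`dim ker Γ_s = 2·#{k : s_k = s_{k+m}}`. Here `s (inl k)` plays the role of `s_k` and
`s (inr k)` that of `s_{k+m}`. -/
theorem number_conserving_quantized_entanglement (m : ℕ) (hm : 1 ≤ m)
    (ψ : Fin m → (Fin (2 * m) → ℂ))
    (hortho : ∀ k l : Fin m ⊕ Fin m,
      star (Sum.elim ψ (fun k' => star (ψ k')) k) ⬝ᵥ
        Sum.elim ψ (fun k' => star (ψ k')) l = if k = l then 1 else 0)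
    (s : Fin m ⊕ Fin m → Fin 2)
    (Γ : Matrix (Fin (2 * m)) (Fin (2 * m)) ℂ)
    (hΓ : ∀ i j, Γ i j = -(Complex.I / 2) * ∑ k : Fin m,
      ((-1 : ℂ) ^ (s (Sum.inl k) : ℕ) - (-1 : ℂ) ^ (s (Sum.inr k) : ℕ)) *
        (ψ k i * starRingEnd ℂ (ψ k j)
          - starRingEnd ℂ (ψ k i * starRingEnd ℂ (ψ k j)))) :
    (∀ i j, ((Complex.I • Γ) * (Complex.I • Γ)) i j
        = ∑ k ∈ Finset.univ.filter (fun k : Fin m => s (Sum.inl k) ≠ s (Sum.inr k)),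
            (ψ k i * starRingEnd ℂ (ψ k j)
              + starRingEnd ℂ (ψ k i) * ψ k j)) ∧
    (∀ μ : ℂ, Module.End.HasEigenvalue (Matrix.toLin' (Complex.I • Γ)) μ →
      μ ∈ ({-1, 0, 1} : Set ℂ)) ∧
    Γ.rank = 2 * (Finset.univ.filter
        (fun k : Fin m => s (Sum.inl k) ≠ s (Sum.inr k))).card ∧
    Module.finrank ℂ (LinearMap.ker (Matrix.toLin' Γ))
      = 2 * (Finset.univ.filter
          (fun k : Fin m => s (Sum.inl k) = s (Sum.inr k))).card := by
  set V : Matrix (Fin (2 * m)) (Fin m ⊕ Fin m) ℂ :=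
    Matrix.of fun i k => Sum.elim ψ (fun k' => star (ψ k')) k i with hVdef
  have hV : Vᴴ * V = 1 := by
    ext k l
    rw [one_apply, ← hortho k l]
    rfl
  set c : Fin m → ℂ := fun k =>
    ((-1 : ℂ) ^ (s (Sum.inl k) : ℕ) - (-1 : ℂ) ^ (s (Sum.inr k) : ℕ)) / 2 with hc
  set d : Fin m ⊕ Fin m → ℂ := Sum.elim c (fun k => -c k) with hd
  have key (e : Fin m ⊕ Fin m → ℂ) (i j : Fin (2 * m)) : (V * diagonal e * Vᴴ) i j
      = ∑ k : Fin m, (e (Sum.inl k) * (ψ k i * starRingEnd ℂ (ψ k j))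
        + e (Sum.inr k) * (starRingEnd ℂ (ψ k i) * ψ k j)) := by
    rw [Matrix.mul_apply, Fintype.sum_sum_type, Finset.sum_add_distrib]
    congr 1 <;> refine Finset.sum_congr rfl fun k _ => ?_ <;>
      simp [hVdef, mul_diagonal] <;> ring
  have hA : Complex.I • Γ = V * diagonal d * Vᴴ := by
    ext i j
    rw [key, Matrix.smul_apply, hΓ, smul_eq_mul, Finset.mul_sum, Finset.mul_sum]
    refine Finset.sum_congr rfl fun k _ => ?_
    simp only [hd, hc, Sum.elim_inl, Sum.elim_inr, map_mul, Complex.conj_conj]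
    linear_combination (-(1 / 2 : ℂ) *
      ((-1 : ℂ) ^ (s (Sum.inl k) : ℕ) - (-1 : ℂ) ^ (s (Sum.inr k) : ℕ)) *
        (ψ k i * starRingEnd ℂ (ψ k j) - starRingEnd ℂ (ψ k i) * ψ k j)) * Complex.I_mul_I
  have hcsq (k : Fin m) : c k * c k = if s (Sum.inl k) ≠ s (Sum.inr k) then 1 else 0 := by
    simp only [hc]
    generalize s (Sum.inl k) = a
    generalize s (Sum.inr k) = b
    fin_cases a <;> fin_cases b <;> norm_num
  have hc0 (k : Fin m) : c k ≠ 0 ↔ s (Sum.inl k) ≠ s (Sum.inr k) := by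
    rw [← mul_self_ne_zero, hcsq]
    simp
  have hccc (k : Fin m) : c k * c k * c k = c k := by
    by_cases h : c k = 0
    · simp [h]
    · rw [hcsq, if_pos ((hc0 k).1 h), one_mul]
  have hrank : Γ.rank = 2 * (Finset.univ.filter
      (fun k : Fin m => s (Sum.inl k) ≠ s (Sum.inr k))).card := by
    have hI : (Complex.I • Γ).rank = Γ.rank :=
      rank_smul_of_mem_nonZeroDivisors Γ (mem_nonZeroDivisors_of_ne_zero Complex.I_ne_zero)
    rw [← hI, hA, rank_unitary_conj_diagonal V hV]
    simp only [Finset.card_filter, Fintype.sum_sum_type, hd, Sum.elim_inl, Sum.elim_inr,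
      neg_ne_zero, hc0, two_mul]
  refine ⟨fun i j => ?_, fun μ hμ => eigenvalue_mem_of_cube_eq _ ?_ μ hμ, hrank, ?_⟩
  · rw [hA, unitary_conj_diagonal_mul V hV, key, Finset.sum_filter]
    refine Finset.sum_congr rfl fun k _ => ?_
    simp only [hd, Sum.elim_inl, Sum.elim_inr, neg_mul_neg, hcsq]
    split_ifs <;> ring
  · rw [hA, unitary_conj_diagonal_mul V hV, unitary_conj_diagonal_mul V hV]
    congr 3
    funext k
    rcases k with k | k <;> simp [hd, hccc]
  · have h1 := LinearMap.finrank_range_add_finrank_ker (Matrix.toLin' Γ)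
    have h2 : finrank ℂ (LinearMap.range (Matrix.toLin' Γ)) = Γ.rank := rfl
    have h3 := Finset.card_filter_add_card_filter_not (s := (Finset.univ : Finset (Fin m)))
      (fun k : Fin m => s (Sum.inl k) = s (Sum.inr k))
    rw [h2, hrank, finrank_fin_fun] at h1
    rw [Finset.card_univ, Fintype.card_fin] at h3
    simp only [ne_eq] at h1
    omega
end

section
/- Let h_M be a real antisymmetric 2N×2N matrix indexed by pairs (j, α), j ∈ {1,…,N}, α ∈ {1,2}, let n := 1_N ⊗ J_2 with J_2 = [[0, −1],[1, 0]], and let S := s ⊗ 1_2 where s is a real diagonal N×N matrix with diagonal entries in {+1, −1}. Assume h_M n = n h_M and S h_M S = −h_M. Then every eigenvalue of the Hermitian matrix −i h_M has multiplicity at least 2. -/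
open Matrix Kronecker Module

open scoped ComplexOrder in
/-- The eigenvalues of a Hermitian matrix are real. -/
theorem Matrix.IsHermitian.star_eq_of_mulVec_eq_smul {ι : Type*} [Fintype ι]
    {A : Matrix ι ι ℂ} (hA : A.IsHermitian) {v : ι → ℂ} (hv : v ≠ 0) {μ : ℂ}
    (h : A *ᵥ v = μ • v) : star μ = μ := by
  have h₁ : star v ⬝ᵥ (A *ᵥ v) = μ * (star v ⬝ᵥ v) := by
    rw [h, dotProduct_smul, smul_eq_mul]
  have h₂ : star v ⬝ᵥ (A *ᵥ v) = star μ * (star v ⬝ᵥ v) := by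
    rw [dotProduct_mulVec, ← hA.eq, ← star_mulVec, h, star_smul, smul_dotProduct, smul_eq_mul]
  have h₃ : star v ⬝ᵥ v ≠ 0 := mt dotProduct_star_self_eq_zero.mp hv
  exact mul_right_cancel₀ h₃ (h₂.symm.trans h₁)

/-- Complex conjugation commutes with the action of a real matrix. -/
theorem Matrix.star_map_ofReal_mulVec {ι κ : Type*} [Fintype κ]
    (B : Matrix ι κ ℝ) (v : κ → ℂ) :
    star (B.map ((↑) : ℝ → ℂ) *ᵥ v) = B.map ((↑) : ℝ → ℂ) *ᵥ star v := by
  ext i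
  simp [mulVec, dotProduct]

/-- `-i h` is Hermitian when `h` is real antisymmetric. -/
theorem Matrix.isHermitian_neg_I_smul_map {ι : Type*} {h : Matrix ι ι ℝ} (hanti : hᵀ = -h) :
    ((-Complex.I) • h.map ((↑) : ℝ → ℂ)).IsHermitian := by
  ext i j
  have hij : h j i = -h i j := congrFun (congrFun hanti i) j
  simp [hij]

/-- Kramers degeneracy: if a real matrix `W` with `W ^ 2 = -1` anticommutes with the real
antisymmetric matrix `h`, then the antilinear map `v ↦ W v̄` commutes with `-i h` and squares
to `-1`, so every eigenvalue of `-i h` is at least doubly degenerate. -/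
theorem Matrix.two_le_finrank_eigenspace_of_anticommute {ι : Type*} [Fintype ι] [DecidableEq ι]
    {h W : Matrix ι ι ℝ} (hanti : hᵀ = -h) (hW : W * W = -1) (hWh : h * W = -(W * h)) (μ : ℂ)
    (hμ : End.HasEigenvalue (Matrix.toLin' ((-Complex.I) • h.map ((↑) : ℝ → ℂ))) μ) :
    2 ≤ finrank ℂ
      (End.eigenspace (Matrix.toLin' ((-Complex.I) • h.map ((↑) : ℝ → ℂ))) μ) := by
  have hWC : W.map ((↑) : ℝ → ℂ) * W.map ((↑) : ℝ → ℂ) = -1 := by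
    have := congrArg (Complex.ofRealHom.mapMatrix) hW
    rwa [map_mul, map_neg, map_one] at this
  have hWhC : h.map ((↑) : ℝ → ℂ) * W.map ((↑) : ℝ → ℂ)
      = -(W.map ((↑) : ℝ → ℂ) * h.map ((↑) : ℝ → ℂ)) := by
    have := congrArg (Complex.ofRealHom.mapMatrix) hWh
    rwa [map_mul, map_neg, map_mul] at this
  by_contra! hlt
  obtain ⟨⟨v, hvE⟩, hspan⟩ := finrank_le_one_iff.mp (Nat.le_of_lt_succ hlt)
  have hAv : ((-Complex.I) • h.map ((↑) : ℝ → ℂ)) *ᵥ v = μ • v := by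
    rw [← toLin'_apply]
    exact End.mem_eigenspace_iff.mp hvE
  have hv : v ≠ 0 := by
    rintro rfl
    obtain ⟨u, hu⟩ := hμ.exists_hasEigenvector
    obtain ⟨c, hc⟩ := hspan ⟨u, hu.1⟩
    exact hu.2 (by simpa using (congrArg Subtype.val hc).symm)
  have hμr : star μ = μ := (isHermitian_neg_I_smul_map hanti).star_eq_of_mulVec_eq_smul hv hAv
  have hconj : Complex.I • (h.map ((↑) : ℝ → ℂ) *ᵥ star v) = μ • star v := by
    have := congrArg star hAv
    rw [smul_mulVec, star_smul, star_smul, star_map_ofReal_mulVec, hμr] at this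
    simpa using this
  have hTv : W.map ((↑) : ℝ → ℂ) *ᵥ star v ∈
      End.eigenspace (Matrix.toLin' ((-Complex.I) • h.map ((↑) : ℝ → ℂ))) μ := by
    rw [End.mem_eigenspace_iff, toLin'_apply, smul_mulVec, mulVec_mulVec, hWhC, neg_mulVec,
      smul_neg, neg_smul, neg_neg, ← mulVec_mulVec, ← mulVec_smul, hconj, mulVec_smul]
  obtain ⟨c, hc⟩ := hspan ⟨_, hTv⟩
  have hc' : W.map ((↑) : ℝ → ℂ) *ᵥ star v = c • v := (congrArg Subtype.val hc).symm
  have hsq : (star c * c) • v = -v := by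
    have hstar : W.map ((↑) : ℝ → ℂ) *ᵥ v = star c • star v := by
      rw [← star_smul, ← hc', star_map_ofReal_mulVec, star_star]
    calc (star c * c) • v = W.map ((↑) : ℝ → ℂ) *ᵥ (star c • star v) := by
          rw [mulVec_smul, hc', smul_smul]
      _ = -v := by rw [← hstar, mulVec_mulVec, hWC, neg_mulVec, one_mulVec]
  have hc₁ : star c * c = -1 := by
    apply smul_left_injective ℂ hv
    simpa using hsq
  have hre := congrArg Complex.re hc₁
  simp at hre
  nlinarith [mul_self_nonneg c.re, mul_self_nonneg c.im]

/-- Number conservation together with sublattice symmetry forces (at least) double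
degeneracy of all single-particle energies: if the real antisymmetric `h_M` commutes with
`n = 1_N ⊗ J_2` and anticommutes under conjugation by `S = s ⊗ 1_2` (with `s` diagonal
with `±1` entries), then every eigenvalue of the Hermitian matrix `−i h_M` has
multiplicity at least `2`. -/
theorem sublattice_number_conserving_degeneracy (N : ℕ)
    (hM : Matrix (Fin N × Fin 2) (Fin N × Fin 2) ℝ)
    (hanti : hMᵀ = -hM)
    (σ : Fin N → ℝ) (hσ : ∀ j, σ j = 1 ∨ σ j = -1)
    (hcomm : hM * ((1 : Matrix (Fin N) (Fin N) ℝ) ⊗ₖ !![0, -1; 1, 0])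
      = ((1 : Matrix (Fin N) (Fin N) ℝ) ⊗ₖ !![0, -1; 1, 0]) * hM)
    (hchiral :
      (Matrix.diagonal σ ⊗ₖ (1 : Matrix (Fin 2) (Fin 2) ℝ)) * hM *
          (Matrix.diagonal σ ⊗ₖ (1 : Matrix (Fin 2) (Fin 2) ℝ)) = -hM) :
    ∀ μ : ℂ,
      Module.End.HasEigenvalue
        (Matrix.toLin' ((-Complex.I) • hM.map ((↑) : ℝ → ℂ))) μ →
      2 ≤ Module.finrank ℂ
        (Module.End.eigenspace
          (Matrix.toLin' ((-Complex.I) • hM.map ((↑) : ℝ → ℂ))) μ) := by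
  have hσσ : Matrix.diagonal σ * Matrix.diagonal σ = 1 := by
    rw [diagonal_mul_diagonal, ← diagonal_one]
    congr 1
    ext j
    rcases hσ j with hj | hj <;> simp [hj]
  have hJJ : (!![0, -1; 1, 0] : Matrix (Fin 2) (Fin 2) ℝ) * !![0, -1; 1, 0] = -1 := by
    ext i j
    fin_cases i <;> fin_cases j <;> simp
  set S := Matrix.diagonal σ ⊗ₖ (1 : Matrix (Fin 2) (Fin 2) ℝ) with hS
  set n := (1 : Matrix (Fin N) (Fin N) ℝ) ⊗ₖ !![0, -1; 1, 0] with hn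
  have hSS : S * S = 1 := by
    rw [hS, ← mul_kronecker_mul, hσσ, one_mul, one_kronecker_one]
  have hnn : n * n = -1 := by
    rw [hn, ← mul_kronecker_mul, hJJ, one_mul, ← one_kronecker_one]
    ext i j
    exact mul_neg _ _
  have hSn : n * S = S * n := by
    rw [hS, hn, ← mul_kronecker_mul, ← mul_kronecker_mul, one_mul, mul_one, one_mul, mul_one]
  have hhS : hM * S = -(S * hM) := by
    calc hM * S = S * S * (hM * S) := by rw [hSS, one_mul]
      _ = S * (S * hM * S) := by simp only [mul_assoc]
      _ = -(S * hM) := by rw [hchiral, mul_neg]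
  refine fun μ => two_le_finrank_eigenspace_of_anticommute (W := S * n) hanti ?_ ?_ μ
  · rw [mul_assoc, ← mul_assoc n, hSn, mul_assoc, ← mul_assoc, hSS, one_mul, hnn]
  · rw [← mul_assoc, hhS, neg_mul, mul_assoc, hcomm, mul_assoc]
end
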